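/- Let α be a timed transition system on a set X and let R be an equivalence relation on X with quotient map f : X → X/R. Then R is a weak timed bisimulation for α if and only if there exists a family of maps β_t : X/R → 𝒫(Σ_τ × X/R), for t ∈ 𝕋, satisfying the lax-functor conditions ((τ,y) ∈ β_0(y) for all y, and β_t ∘ β_{t'} ≤ β_{t+t'} pointwise under the Kleisli composition), such that f^♯ ∘ W_t = β_t ∘ f^♯ for every t ∈ 𝕋, where W_t : X → 𝒫(Σ_τ × X) is the saturated step map W_t(x) = {(σ,y) | x ⇒^{σ,t} y}. -/

import Mathlib

/- `Option Act` models `Σ_τ`: `none` is the silent label `τ`, `some a` is an action. -/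

/-- Kleisli composition for the LTS monad: `kcomp g f` is `g ∘ f` (`f` applied first). -/
def kcomp {Act X Y Z : Type*} (g : Y → Set (Option Act × Z)) (f : X → Set (Option Act × Y)) :
    X → Set (Option Act × Z) := fun x =>
  {p | ∃ y : Y, ((p.1, y) ∈ f x ∧ ((none, p.2) : Option Act × Z) ∈ g y) ∨
        (((none, y) : Option Act × Y) ∈ f x ∧ (p.1, p.2) ∈ g y)}

/-- Kleisli lifting `f^♯(x) = {(τ, f x)}` of a function `f`. -/
def fsharp {Act X Y : Type*} (f : X → Y) : X → Set (Option Act × Y) :=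
  fun x => {((none : Option Act), f x)}

/-- The saturated step relation `x ⇒^{σ,t} y`: the least relation containing
`x ⇒^{τ,0} x` and closed under `x ⇒^{τ,t₀} x' →^{σ,t₁} y' ⇒^{τ,t₂} y ⟹ x ⇒^{σ,t₀+t₁+t₂} y`. -/
inductive WStep {Act T X : Type*} [AddCommMonoid T]
    (α : X → Set (Option Act × T × X)) : X → Option Act → T → X → Prop
  | refl (x : X) : WStep α x none 0 x
  | step {x x' y' y : X} {σ : Option Act} {t₀ t₁ t₂ : T} :
      WStep α x none t₀ x' → (σ, t₁, y') ∈ α x' → WStep α y' none t₂ y →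
      WStep α x σ (t₀ + t₁ + t₂) y

/-- `R` is a weak timed bisimulation for the TTS `α`. -/
def WeakTimedBisim {Act T X : Type*} [AddCommMonoid T]
    (α : X → Set (Option Act × T × X)) (R : X → X → Prop) : Prop :=
  ∀ x y, R x y → ∀ (σ : Option Act) (t : T) (x' : X),
    WStep α x σ t x' → ∃ y', WStep α y σ t y' ∧ R x' y'

theorem WStep.silent_trans {Act T X : Type*} [AddCommMonoid T]
    {α : X → Set (Option Act × T × X)} {x y z : X} {t t' : T}
    (h : WStep α x none t y) (h' : WStep α y none t' z) : WStep α x none (t + t') z := by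
  generalize hσ : (none : Option Act) = σ at h
  induction h with
  | refl x => simpa using h'
  | step h₁ ha _ _ ih =>
    subst hσ
    rw [add_assoc]
    exact .step h₁ ha (ih h' rfl)

theorem WStep.silent_comp {Act T X : Type*} [AddCommMonoid T]
    {α : X → Set (Option Act × T × X)} {x y z : X} {σ : Option Act} {t t' : T}
    (h : WStep α x none t y) (h' : WStep α y σ t' z) : WStep α x σ (t + t') z := by
  cases h' with
  | refl => simpa using h
  | step h₁ ha h₂ =>
    rw [← add_assoc, ← add_assoc]
    exact .step (h.silent_trans h₁) ha h₂

theorem WStep.comp_silent {Act T X : Type*} [AddCommMonoid T]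
    {α : X → Set (Option Act × T × X)} {x y z : X} {σ : Option Act} {t t' : T}
    (h : WStep α x σ t y) (h' : WStep α y none t' z) : WStep α x σ (t + t') z := by
  cases h with
  | refl => simpa using h'
  | step h₁ ha h₂ =>
    rw [add_assoc]
    exact .step h₁ ha (h₂.silent_trans h')

theorem mem_kcomp_fsharp_left {Act X Y Z : Type*} (f : Y → Z) (g : X → Set (Option Act × Y))
    (x : X) (p : Option Act × Z) :
    p ∈ kcomp (fsharp f) g x ↔ ∃ y, (p.1, y) ∈ g x ∧ f y = p.2 := by
  simp only [kcomp, fsharp, Set.mem_ofPred_eq, Set.mem_singleton_iff, Prod.mk.injEq, true_and]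
  constructor
  · rintro ⟨y, ⟨h, h'⟩ | ⟨h, h₁, h'⟩⟩
    · exact ⟨y, h, h'.symm⟩
    · exact ⟨y, h₁ ▸ h, h'.symm⟩
  · rintro ⟨y, h, h'⟩
    exact ⟨y, .inl ⟨h, h'.symm⟩⟩

theorem mem_kcomp_fsharp_right {Act X Y Z : Type*} (f : X → Y) (g : Y → Set (Option Act × Z))
    (x : X) (p : Option Act × Z) :
    p ∈ kcomp g (fsharp f) x ↔ p ∈ g (f x) := by
  obtain ⟨σ, z⟩ := p
  simp only [kcomp, fsharp, Set.mem_ofPred_eq, Set.mem_singleton_iff, Prod.mk.injEq, true_and]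
  constructor
  · rintro ⟨y, ⟨⟨rfl, rfl⟩, h⟩ | ⟨rfl, h⟩⟩ <;> exact h
  · intro h
    exact ⟨f x, .inr ⟨rfl, h⟩⟩

/-- An equivalence relation `R` on `X` is a weak timed bisimulation for `α` iff there is
a family `β_t : X/R → 𝒫(Σ_τ × X/R)` satisfying the lax-functor conditions and
`f^♯ ∘ W_t = β_t ∘ f^♯` for all `t`, where `W_t` is the saturated step map of `α` and
`f` the quotient map. -/
theorem stmt11 {Act T X : Type*} [AddCommMonoid T]
    (α : X → Set (Option Act × T × X)) (R : X → X → Prop) (hR : Equivalence R) :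
    WeakTimedBisim α R ↔
      ∃ β : T → Quotient (⟨R, hR⟩ : Setoid X) → Set (Option Act × Quotient (⟨R, hR⟩ : Setoid X)),
        (∀ y, ((none : Option Act), y) ∈ β 0 y) ∧
        (∀ (t t' : T) (y), kcomp (β t) (β t') y ⊆ β (t + t') y) ∧
        (∀ t : T,
          kcomp (fsharp (Quotient.mk (⟨R, hR⟩ : Setoid X)))
              (fun x => {p : Option Act × X | WStep α x p.1 t p.2})
            = kcomp (β t) (fsharp (Quotient.mk (⟨R, hR⟩ : Setoid X)))) := by
  constructor
  · intro hB
    refine ⟨fun t q => {p | ∃ x y, Quotient.mk _ x = q ∧ WStep α x p.1 t y ∧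
      Quotient.mk _ y = p.2}, ?_, ?_, ?_⟩
    · intro q
      obtain ⟨x, rfl⟩ := Quotient.exists_rep q
      exact ⟨x, x, rfl, .refl x, rfl⟩
    · rintro t t' q ⟨σ, r⟩ ⟨m, ⟨⟨x, y, rfl, h, rfl⟩, ⟨u, v, hu, h', rfl⟩⟩ |
        ⟨⟨x, y, rfl, h, rfl⟩, ⟨u, v, hu, h', rfl⟩⟩⟩
      all_goals
        obtain ⟨w, hw, hvw⟩ := hB u y (Quotient.exact hu) _ _ _ h'
        refine ⟨x, w, rfl, ?_, (Quotient.sound hvw).symm⟩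
        rw [add_comm]
      · exact h.comp_silent hw
      · exact h.silent_comp hw
    · intro t
      ext x p
      rw [mem_kcomp_fsharp_left, mem_kcomp_fsharp_right]
      constructor
      · rintro ⟨y, h, hy⟩
        exact ⟨x, y, rfl, h, hy⟩
      · rintro ⟨u, v, hu, h, hv⟩
        obtain ⟨w, hw, hvw⟩ := hB u x (Quotient.exact hu) _ _ _ h
        exact ⟨w, hw, (Quotient.sound hvw).symm.trans hv⟩
  · rintro ⟨β, -, -, hβ⟩ x y hxy σ t x' h
    have key (z : X) (p) := by
      have := Set.ext_iff.mp (congrFun (hβ t) z) p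
      rwa [mem_kcomp_fsharp_left, mem_kcomp_fsharp_right] at this
    have hx := (key x (σ, Quotient.mk _ x')).mp ⟨x', h, rfl⟩
    have hq : Quotient.mk (⟨R, hR⟩ : Setoid X) x = Quotient.mk _ y := Quotient.sound hxy
    rw [hq] at hx
    obtain ⟨y', hy', he⟩ := (key y _).mpr hx
    exact ⟨y', hy', hR.symm (Quotient.exact he)⟩
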